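/- Let α ∈ [0,1] and let T be a tree on n ≥ 4 vertices that is neither the star K_{1,n−1} nor the path P_n. Then the D_α-spectral radius of the complement of T is strictly greater than that of the complement of P_n: ρ_α(T̄) > ρ_α(P̄_n). -/

import Mathlib

open SimpleGraph Matrix BigOperators Finset

noncomputable section

/-- Distance matrix of a graph on `Fin n`, with real entries. -/
def distM {n : ℕ} (G : SimpleGraph (Fin n)) : Matrix (Fin n) (Fin n) ℝ :=
  fun i j => (G.dist i j : ℝ)

/-- Transmission of a vertex: sum of distances to all vertices. -/
def transm {n : ℕ} (G : SimpleGraph (Fin n)) (i : Fin n) : ℝ :=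
  ∑ j, (G.dist i j : ℝ)

/-- Diagonal matrix of transmissions. -/
def trM {n : ℕ} (G : SimpleGraph (Fin n)) : Matrix (Fin n) (Fin n) ℝ :=
  Matrix.diagonal (transm G)

/-- Distance signless Laplacian. -/
def DQ {n : ℕ} (G : SimpleGraph (Fin n)) : Matrix (Fin n) (Fin n) ℝ :=
  trM G + distM G

/-- The `D_α` matrix. -/
def Dalpha {n : ℕ} (G : SimpleGraph (Fin n)) (α : ℝ) : Matrix (Fin n) (Fin n) ℝ :=
  α • trM G + (1 - α) • distM G

/-- Largest eigenvalue of a real matrix. -/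
def lam1 {n : ℕ} (M : Matrix (Fin n) (Fin n) ℝ) : ℝ :=
  sSup {t : ℝ | ∃ v : Fin n → ℝ, v ≠ 0 ∧ M.mulVec v = t • v}

/-- Degree of a vertex. -/
def deg {n : ℕ} (G : SimpleGraph (Fin n)) (x : Fin n) : ℕ :=
  (G.neighborSet x).ncard

/-- Number of pendant (degree-one) vertices. -/
def pendants {n : ℕ} (G : SimpleGraph (Fin n)) : ℕ :=
  {x : Fin n | deg G x = 1}.ncard

/-- Diameter: supremum of pairwise distances. -/
def gdiam {n : ℕ} (G : SimpleGraph (Fin n)) : ℕ :=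
  sSup {d : ℕ | ∃ x y : Fin n, G.dist x y = d}

/-- The graph obtained by moving all edges at `v` except `vw` to `u`. -/
def shift {n : ℕ} (T : SimpleGraph (Fin n)) (u v w : Fin n) : SimpleGraph (Fin n) :=
  SimpleGraph.fromRel (fun a b =>
    (T.Adj a b ∧ ((a ≠ v ∧ b ≠ v) ∨ (a = v ∧ b = w) ∨ (b = v ∧ a = w))) ∨
    (a = u ∧ T.Adj v b ∧ b ≠ w))

/-- `T₁` is obtained from `T` by a proper generalized tree shift. -/
def IsProperGTS {n : ℕ} (T T₁ : SimpleGraph (Fin n)) : Prop :=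
  ∃ (u v w : Fin n) (p : T.Walk u v), u ≠ v ∧ p.IsPath ∧
    T.Adj w v ∧ w ∈ p.support ∧
    (∀ x ∈ p.support, x ≠ u → x ≠ v → deg T x = 2) ∧
    deg T u ≠ 1 ∧ deg T v ≠ 1 ∧ T₁ = shift T u v w

/-- The Kelmans transformation at vertices `u`, `v`. -/
def kelmans {n : ℕ} (T : SimpleGraph (Fin n)) (u v : Fin n) : SimpleGraph (Fin n) :=
  SimpleGraph.fromRel (fun a b =>
    (T.Adj a b ∧ ¬(a = v ∧ ¬T.Adj u b ∧ b ≠ u) ∧ ¬(b = v ∧ ¬T.Adj u a ∧ a ≠ u)) ∨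
    (a = u ∧ T.Adj v b ∧ ¬T.Adj u b ∧ b ≠ u))

/-- Collapse the edge `ab` (identifying into `a`) and reuse `b` as a new pendant at `a`. -/
def collapseAddPendant {n : ℕ} (T : SimpleGraph (Fin n)) (a b : Fin n) : SimpleGraph (Fin n) :=
  SimpleGraph.fromRel (fun x y =>
    (x ≠ a ∧ x ≠ b ∧ y ≠ a ∧ y ≠ b ∧ T.Adj x y) ∨
    (x = a ∧ y ≠ a ∧ y ≠ b ∧ (T.Adj a y ∨ T.Adj b y)) ∨
    (x = a ∧ y = b))

/-- The star `K_{1,n-1}` with centre `0`. -/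
def starG (n : ℕ) [NeZero n] : SimpleGraph (Fin n) :=
  SimpleGraph.fromRel (fun a b => a = 0 ∨ b = 0)

/-- Irreducibility of a nonnegative matrix. -/
def IrreducibleM {n : ℕ} (M : Matrix (Fin n) (Fin n) ℝ) : Prop :=
  ∀ i j : Fin n, i ≠ j → ∃ k : ℕ, 0 < (M ^ k) i j


/-- `T` is a star: some centre is adjacent to exactly the other vertices, and
there are no other edges. -/
def IsStar {n : ℕ} (T : SimpleGraph (Fin n)) : Prop :=
  ∃ c : Fin n, ∀ a b : Fin n, T.Adj a b ↔ (a ≠ b ∧ (a = c ∨ b = c))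

/-- The all-ones matrix. -/
def Jmat (n : ℕ) : Matrix (Fin n) (Fin n) ℝ := Matrix.of fun _ _ => 1


/-! Spectral facts -/

theorem lam_finite {n : ℕ} (M : Matrix (Fin n) (Fin n) ℝ) :
    {t : ℝ | ∃ v : Fin n → ℝ, v ≠ 0 ∧ M.mulVec v = t • v}.Finite := by
  refine (Module.End.finite_hasEigenvalue (Matrix.toLin' M)).subset ?_
  rintro t ⟨v, hv, h⟩
  exact Module.End.hasEigenvalue_of_hasEigenvector
    (Module.End.hasEigenvector_iff.2 ⟨Module.End.mem_eigenspace_iff.2 (by simpa using h), hv⟩)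

theorem lam_le {n : ℕ} (M : Matrix (Fin n) (Fin n) ℝ) {t : ℝ} {v : Fin n → ℝ} (hv : v ≠ 0)
    (h : M.mulVec v = t • v) : t ≤ lam1 M :=
  le_csSup (lam_finite M).bddAbove ⟨v, hv, h⟩

theorem herm_eig {n : ℕ} (M : Matrix (Fin n) (Fin n) ℝ) (hM : M.IsHermitian) (i : Fin n) :
    ∃ v : Fin n → ℝ, v ≠ 0 ∧ M.mulVec v = hM.eigenvalues i • v := by
  refine ⟨hM.eigenvectorBasis i, ?_, hM.mulVec_eigenvectorBasis i⟩
  intro h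
  have h2 := hM.eigenvectorBasis.orthonormal.ne_zero i
  apply h2
  ext j
  exact congrFun h j

theorem lam_mem {n : ℕ} (hn : 0 < n) (M : Matrix (Fin n) (Fin n) ℝ) (hM : M.IsHermitian) :
    ∃ v : Fin n → ℝ, v ≠ 0 ∧ M.mulVec v = lam1 M • v := by
  have : ({t : ℝ | ∃ v : Fin n → ℝ, v ≠ 0 ∧ M.mulVec v = t • v}).Nonempty :=
    ⟨_, herm_eig M hM ⟨0, hn⟩⟩
  exact this.csSup_mem (lam_finite M)

theorem lam_psd {n : ℕ} (M : Matrix (Fin n) (Fin n) ℝ) (hM : M.IsHermitian) :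
    (lam1 M • (1 : Matrix (Fin n) (Fin n) ℝ) - M).PosSemidef := by
  have hN : (lam1 M • (1 : Matrix (Fin n) (Fin n) ℝ) - M).IsHermitian := by
    refine Matrix.IsHermitian.sub ?_ hM
    simp [Matrix.IsHermitian]
  rw [hN.posSemidef_iff_eigenvalues_nonneg]
  intro i
  obtain ⟨v, hv, h⟩ := herm_eig _ hN i
  have : M.mulVec v = (lam1 M - hN.eigenvalues i) • v := by
    rw [sub_smul, ← h, Matrix.sub_mulVec, Matrix.smul_mulVec, Matrix.one_mulVec]
    abel
  have := lam_le M hv this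
  simp only [Pi.zero_apply]
  linarith

theorem lam_ray {n : ℕ} (M : Matrix (Fin n) (Fin n) ℝ) (hM : M.IsHermitian) (v : Fin n → ℝ) :
    v ⬝ᵥ M.mulVec v ≤ lam1 M * (v ⬝ᵥ v) := by
  have := (lam_psd M hM).dotProduct_mulVec_nonneg v
  rw [Matrix.sub_mulVec, Matrix.smul_mulVec, Matrix.one_mulVec, dotProduct_sub,
    dotProduct_smul] at this
  simp at this
  linarith

theorem lam_eq {n : ℕ} (M : Matrix (Fin n) (Fin n) ℝ) (hM : M.IsHermitian) (v : Fin n → ℝ)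
    (h : lam1 M * (v ⬝ᵥ v) ≤ v ⬝ᵥ M.mulVec v) : M.mulVec v = lam1 M • v := by
  have h1 := (lam_psd M hM).dotProduct_mulVec_zero_iff v
  have h2 := lam_ray M hM v
  rw [Matrix.sub_mulVec, Matrix.smul_mulVec, Matrix.one_mulVec, dotProduct_sub,
    dotProduct_smul] at h1
  have := h1.1 (by simp; linarith)
  exact (sub_eq_zero.1 this).symm

theorem Dalpha_herm {n : ℕ} (G : SimpleGraph (Fin n)) (α : ℝ) : (Dalpha G α).IsHermitian := by
  ext i j
  simp only [Dalpha, trM, distM, Matrix.conjTranspose_apply, Matrix.add_apply, Matrix.smul_apply,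
    Matrix.diagonal_apply, star_trivial, smul_eq_mul]
  rw [SimpleGraph.dist_comm]
  by_cases h : i = j
  · subst h; rfl
  · simp [h, Ne.symm h]

theorem Dalpha_mulVec {n : ℕ} (G : SimpleGraph (Fin n)) (α : ℝ) (v : Fin n → ℝ) (i : Fin n) :
    (Dalpha G α).mulVec v i = ∑ j, (G.dist i j : ℝ) * (α * v i + (1 - α) * v j) := by
  rw [Dalpha, Matrix.add_mulVec, Matrix.smul_mulVec, Matrix.smul_mulVec, trM]
  simp only [Pi.add_apply, Pi.smul_apply, Matrix.mulVec_diagonal, smul_eq_mul, transm]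
  simp only [Matrix.mulVec, dotProduct, distM]
  rw [Finset.sum_mul, Finset.mul_sum, Finset.mul_sum, ← Finset.sum_add_distrib]
  exact Finset.sum_congr rfl fun j _ => by ring

theorem Dalpha_quad {n : ℕ} (G : SimpleGraph (Fin n)) (α : ℝ) (v : Fin n → ℝ) :
    v ⬝ᵥ (Dalpha G α).mulVec v
      = ∑ i, ∑ j, (G.dist i j : ℝ) * (α * v i ^ 2 + (1 - α) * (v i * v j)) := by
  simp only [dotProduct, Dalpha_mulVec, Finset.mul_sum]
  exact Finset.sum_congr rfl fun i _ => Finset.sum_congr rfl fun j _ => by ring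

theorem iso_edist_le {V W : Type} {G : SimpleGraph V} {H : SimpleGraph W} (e : G ≃g H) (u v : V) :
    H.edist (e u) (e v) ≤ G.edist u v := by
  by_cases h : G.edist u v = ⊤
  · rw [h]; exact le_top
  · obtain ⟨p, hp⟩ := SimpleGraph.exists_walk_of_edist_ne_top h
    rw [← hp]
    simpa using SimpleGraph.edist_le (p.map e.toHom)

theorem iso_dist {V W : Type} {G : SimpleGraph V} {H : SimpleGraph W} (e : G ≃g H) (u v : V) :
    H.dist (e u) (e v) = G.dist u v := by
  have h1 := iso_edist_le e u v
  have h2 := iso_edist_le e.symm (e u) (e v)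
  simp at h2
  unfold SimpleGraph.dist
  rw [le_antisymm h1 h2]

theorem lam1_le_iso {n : ℕ} {G H : SimpleGraph (Fin n)} (e : G ≃g H) (α : ℝ) :
    {t : ℝ | ∃ v : Fin n → ℝ, v ≠ 0 ∧ (Dalpha H α).mulVec v = t • v} ⊆
    {t : ℝ | ∃ v : Fin n → ℝ, v ≠ 0 ∧ (Dalpha G α).mulVec v = t • v} := by
  rintro t ⟨v, hv, h⟩
  refine ⟨fun i => v (e i), ?_, ?_⟩
  · intro h0; apply hv; ext i
    have := congrFun h0 (e.symm i)
    simpa using this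
  · ext i
    have h1 := congrFun h (e i)
    rw [Dalpha_mulVec] at h1 ⊢
    simp only [Pi.smul_apply] at h1 ⊢
    rw [← h1, ← Equiv.sum_comp e.toEquiv
      (fun j => (H.dist (e i) j : ℝ) * (α * v (e i) + (1 - α) * v j))]
    refine Finset.sum_congr rfl fun j _ => ?_
    have := iso_dist e i j
    simp [this]

theorem lam1_iso {n : ℕ} {G H : SimpleGraph (Fin n)} (e : G ≃g H) (α : ℝ) :
    lam1 (Dalpha G α) = lam1 (Dalpha H α) := by
  unfold lam1
  rw [Set.Subset.antisymm (lam1_le_iso e.symm α) (lam1_le_iso e α)]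

/-- complement of an isomorphism -/
def complIso {V W : Type} {G : SimpleGraph V} {H : SimpleGraph W} (e : G ≃g H) : Gᶜ ≃g Hᶜ where
  toEquiv := e.toEquiv
  map_rel_iff' := by
    intro a b
    have := e.map_adj_iff (v := a) (w := b)
    simp only [SimpleGraph.compl_adj]
    simp [this]

/-! Trees given by a parent function -/

/-- graph on `Fin n` with edges `k ~ p k` for `k ≥ 1` -/
def parG (n : ℕ) (p : ℕ → ℕ) : SimpleGraph (Fin n) where
  Adj i j := i ≠ j ∧ ((0 < i.val ∧ p i.val = j.val) ∨ (0 < j.val ∧ p j.val = i.val))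
  symm := ⟨fun _ _ h => ⟨h.1.symm, h.2.symm⟩⟩
  loopless := ⟨fun _ h => h.1 rfl⟩

theorem order_aux (m : ℕ) : ∀ (V : Type) [Fintype V] (G : SimpleGraph V), G.IsTree →
    Fintype.card V = m + 2 → ∀ w : V, ∃ p : ℕ → ℕ, (∀ k, p k ≤ k - 2) ∧
      ∃ e : G ≃g parG (m + 2) p, (e w).val ≠ m + 1 := by
  classical
  induction m with
  | zero =>
    intro V _ G hG hc w
    have hnt : Nontrivial V := Fintype.one_lt_card_iff_nontrivial.1 (by omega)
    obtain ⟨e0⟩ : Nonempty (V ≃ Fin 2) := ⟨Fintype.equivFinOfCardEq hc⟩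
    let e1 : V ≃ Fin 2 := e0.trans (Equiv.swap (e0 w) 0)
    have hadj : ∀ a b, a ≠ b → G.Adj a b := by
      intro a b hab
      obtain ⟨c, hc'⟩ := hG.connected.preconnected.exists_adj_of_nontrivial a
      have : c = b := by
        apply e0.injective
        have h1 : e0 c ≠ e0 a := fun h => hc'.ne (e0.injective h).symm
        have h2 : e0 b ≠ e0 a := fun h => hab (e0.injective h).symm
        ext; simp only [ne_eq, Fin.ext_iff] at h1 h2; omega
      exact this ▸ hc'
    refine ⟨fun _ => 0, fun k => Nat.zero_le _, ⟨e1, ?_⟩, ?_⟩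
    · intro a b
      constructor
      · intro h; exact hadj a b (fun hab => h.1 (by rw [hab]))
      · intro h
        have : e1 a ≠ e1 b := fun hh => h.ne (e1.injective hh)
        refine ⟨this, ?_⟩
        simp only [ne_eq, Fin.ext_iff] at this
        have := (e1 a).2
        have := (e1 b).2
        simp only
        omega
    · simp [e1]
  | succ m ih =>
    intro V _ G hG hc w
    have hnt : Nontrivial V := Fintype.one_lt_card_iff_nontrivial.1 (by omega)
    obtain ⟨v, hvw, hdeg⟩ : ∃ v, v ≠ w ∧ G.degree v = 1 := by
      obtain ⟨u, v, huv, hu, hv⟩ := hG.exists_ne_and_degree_eq_one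
      by_cases h : u = w
      · exact ⟨v, fun h' => huv (h.trans h'.symm), by convert hv⟩
      · exact ⟨u, h, by convert hu⟩
    obtain ⟨u, huv, huniq⟩ := SimpleGraph.degree_eq_one_iff_existsUnique_adj.1 hdeg
    have hT' : (G.induce {v}ᶜ).IsTree :=
      ⟨hG.connected.induce_compl_singleton_of_degree_eq_one hdeg, hG.isAcyclic.induce _⟩
    have hcard : Fintype.card ({v}ᶜ : Set V) = m + 2 := by
      rw [Fintype.card_compl_set]; simp; omega
    obtain ⟨p, hp, e, he⟩ := ih _ _ hT' hcard ⟨u, by simpa using huv.ne.symm⟩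
    set q : ℕ → ℕ := fun k => if k = m + 2 then (e ⟨u, by simpa using huv.ne.symm⟩).val else p k
      with hq
    let f : V → Fin (m + 1 + 2) := fun x =>
      if h : x = v then ⟨m + 2, by omega⟩ else ⟨(e ⟨x, h⟩).val, by have := (e ⟨x, h⟩).2; omega⟩
    have fv : (f v).val = m + 2 := by simp [f]
    have fx : ∀ x (h : x ≠ v), (f x).val = (e ⟨x, h⟩).val := by intro x h; simp [f, h]
    have finj : Function.Injective f := by
      intro a b hab
      have hab' : (f a).val = (f b).val := by rw [hab]
      by_cases ha : a = v <;> by_cases hb : b = v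
      · rw [ha, hb]
      · rw [ha, fv, fx b hb] at hab'; have := (e ⟨b, hb⟩).2; omega
      · rw [hb, fv, fx a ha] at hab'; have := (e ⟨a, ha⟩).2; omega
      · rw [fx a ha, fx b hb] at hab'
        have := e.injective (Fin.ext hab')
        exact congrArg Subtype.val this
    have fbij : Function.Bijective f :=
      (Fintype.bijective_iff_injective_and_card f).2 ⟨finj, by simp [hc]⟩
    have hqlt : ∀ k, k < m + 2 → q k = p k := by intro k hk; simp [hq]; omega
    have hqv : q (m + 2) = (f u).val := by rw [fx u huv.ne.symm]; simp [hq]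
    have hadjv : ∀ b, G.Adj v b ↔ (parG (m + 1 + 2) q).Adj (f v) (f b) := by
      intro b
      constructor
      · intro h
        have hb : b = u := huniq b h
        subst hb
        exact ⟨fun h' => h.ne (finj h'), Or.inl ⟨by omega, by rw [fv, hqv]⟩⟩
      · rintro ⟨h1, h2⟩
        have hb : b ≠ v := fun hh => h1 (by rw [hh])
        have hlt : (f b).val < m + 2 := by rw [fx b hb]; exact (e ⟨b, hb⟩).2
        rcases h2 with h2 | h2
        · rw [fv, hqv] at h2
          have : u = b := finj (Fin.ext h2.2)
          exact this ▸ huv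
        · rw [hqlt _ hlt, fv] at h2
          have := hp (f b).val
          omega
    have hadj : ∀ a b, (parG (m + 1 + 2) q).Adj (f a) (f b) ↔ G.Adj a b := by
      intro a b
      by_cases ha : a = v
      · subst ha; exact (hadjv b).symm
      by_cases hb : b = v
      · subst hb; rw [SimpleGraph.adj_comm, G.adj_comm]; exact (hadjv a).symm
      have h0 := e.map_adj_iff (v := ⟨a, ha⟩) (w := ⟨b, hb⟩)
      simp only [SimpleGraph.comap_adj, Function.Embedding.subtype_apply] at h0
      rw [← h0]
      have l1 : (f a).val < m + 2 := by rw [fx a ha]; exact (e ⟨a, ha⟩).2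
      have l2 : (f b).val < m + 2 := by rw [fx b hb]; exact (e ⟨b, hb⟩).2
      simp only [parG, ne_eq, Fin.ext_iff]
      rw [hqlt _ l1, hqlt _ l2, fx a ha, fx b hb]
      exact Iff.rfl
    refine ⟨q, ?_, ⟨Equiv.ofBijective f fbij, ?_⟩, ?_⟩
    · intro k
      by_cases hk : k = m + 2
      · subst hk
        have := (e ⟨u, by simpa using huv.ne.symm⟩).2
        simp only [hq, if_true]
        omega
      · simp only [hq, hk, if_false]; exact hp k
    · intro a b; exact hadj a b
    · change (f w).val ≠ _
      rw [fx w hvw.symm]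
      have := (e ⟨w, hvw.symm⟩).2
      omega

/-- the zigzag model of the path -/
theorem path_zig (n : ℕ) : Nonempty (SimpleGraph.pathGraph n ≃g parG n (fun k => k - 2)) := by
  let f : Fin n → Fin n := fun k =>
    if (n - 1 - k.val) % 2 = 0 then ⟨(n - 1 - k.val) / 2, by omega⟩
    else ⟨n - 1 - (n - 1 - k.val) / 2, by omega⟩
  have hf : ∀ k, (f k).val = if (n - 1 - k.val) % 2 = 0 then (n - 1 - k.val) / 2
      else n - 1 - (n - 1 - k.val) / 2 := by
    intro k; simp only [f]; split_ifs <;> rfl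
  have finj : Function.Injective f := by
    intro a b hab
    have h : (f a).val = (f b).val := by rw [hab]
    rw [hf, hf] at h
    ext
    have := a.2; have := b.2
    split_ifs at h <;> omega
  have fbij : Function.Bijective f := Finite.injective_iff_bijective.1 finj
  refine ⟨RelIso.symm ⟨Equiv.ofBijective f fbij, ?_⟩⟩
  intro a b
  change (SimpleGraph.pathGraph n).Adj (f a) (f b) ↔ _
  rw [SimpleGraph.pathGraph_adj, hf, hf]
  simp only [parG, ne_eq, Fin.ext_iff]
  have := a.2; have := b.2
  split_ifs <;> omega

/-! Distances in complements -/

/-- lower model for the distance in the complement -/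
def wt {n : ℕ} (G : SimpleGraph (Fin n)) (i j : Fin n) : ℝ :=
  by classical exact (if i = j then 0 else 1) + (if G.Adj i j then 1 else 0)

theorem wt_le {n : ℕ} (G : SimpleGraph (Fin n)) (h : Gᶜ.Preconnected) (i j : Fin n) :
    wt G i j ≤ (Gᶜ.dist i j : ℝ) := by
  classical
  unfold wt
  by_cases hij : i = j
  · subst hij; simp
  · by_cases ha : G.Adj i j
    · have : 2 ≤ Gᶜ.dist i j :=
        (h i j).one_lt_dist_of_ne_of_not_adj hij (by simp [ha])
      have : (2 : ℝ) ≤ Gᶜ.dist i j := by exact_mod_cast this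
      simp only [hij, ha, if_true, if_false]; linarith
    · have : 1 ≤ Gᶜ.dist i j := (h i j).pos_dist_of_ne hij
      have : (1 : ℝ) ≤ Gᶜ.dist i j := by exact_mod_cast this
      simp only [hij, ha, if_false]; linarith

theorem reach_of {n : ℕ} (G : SimpleGraph (Fin n)) (hstar : ¬ IsStar G)
    (tri : ∀ a b c, G.Adj a b → G.Adj b c → ¬ G.Adj a c)
    (c4 : ∀ a u v b, G.Adj a u → G.Adj u v → G.Adj v b → G.Adj b a → a ≠ v → b ≠ u → False) :
    Gᶜ.Preconnected := by
  have key : ∀ u v, G.Adj u v → ∃ b, b ≠ u ∧ G.Adj b v ∨ (b ≠ u ∧ b ≠ v ∧ ¬ G.Adj b u ∧ ¬ G.Adj b v) := by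
    intro u v huv
    by_contra hcon
    push Not at hcon
    apply hstar
    have hu : ∀ x, x ≠ u → G.Adj x u := by
      intro x hx
      by_cases hxv : x = v
      · subst hxv; exact huv.symm
      · by_contra h
        exact (hcon x).1 hx ((hcon x).2 hx hxv h)
    refine ⟨u, fun a b => ⟨fun h => ⟨h.ne, ?_⟩, ?_⟩⟩
    · by_contra hh
      push Not at hh
      exact tri a b u h (hu b hh.2) (hu a hh.1)
    · rintro ⟨hab, rfl | rfl⟩
      · exact (hu b hab.symm).symm
      · exact hu a hab
  have cadj : ∀ a b, a ≠ b → ¬ G.Adj a b → Gᶜ.Reachable a b := by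
    intro a b h1 h2
    exact SimpleGraph.Adj.reachable (by simp [h1, h2])
  intro u v
  by_cases huv : u = v
  · subst huv; exact SimpleGraph.Reachable.refl _
  by_cases ha : G.Adj u v
  · obtain ⟨b, hb⟩ := key u v ha
    obtain ⟨a, ha'⟩ := key v u ha.symm
    rcases hb with ⟨hb1, hb2⟩ | ⟨hb1, hb2, hb3, hb4⟩
    · rcases ha' with ⟨ha1, ha2⟩ | ⟨ha1, ha2, ha3, ha4⟩
      · have h1 : Gᶜ.Reachable u b := cadj u b hb1.symm (tri u v b ha hb2.symm)
        have h2 : Gᶜ.Reachable b a := by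
          refine cadj b a ?_ ?_
          · rintro rfl; exact tri b u v ha2 ha hb2
          · intro h; exact c4 a u v b ha2 ha hb2.symm h ha1 hb1
        have h3 : Gᶜ.Reachable a v := cadj a v ha1 (tri a u v ha2 ha)
        exact h1.trans (h2.trans h3)
      · exact (cadj a u ha2 ha4).symm.trans (cadj a v ha1 ha3)
    · exact (cadj b u hb1 hb3).symm.trans (cadj b v hb2 hb4)
  · exact cadj u v huv ha

theorem par_reach {n : ℕ} {p : ℕ → ℕ} (hp : ∀ k, p k ≤ k - 2) (hstar : ¬ IsStar (parG n p)) :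
    (parG n p)ᶜ.Preconnected := by
  refine reach_of _ hstar ?_ ?_
  · intro a b c h1 h2 h3
    have pa := hp a; have pb := hp b; have pc := hp c
    simp only [parG, ne_eq, Fin.ext_iff] at h1 h2 h3
    omega
  · intro a u v b h1 h2 h3 h4 h5 h6
    have pa := hp a; have pb := hp b; have pu := hp u; have pv := hp v
    simp only [parG, ne_eq, Fin.ext_iff] at h1 h2 h3 h4 h5 h6
    omega

theorem zig_dist {n : ℕ} (hn : 5 ≤ n) (i j : Fin n) :
    ((parG n (fun k => k - 2))ᶜ.dist i j : ℝ) = wt (parG n (fun k => k - 2)) i j := by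
  classical
  set G := parG n (fun k => k - 2) with hG
  unfold wt
  by_cases hij : i = j
  · subst hij; simp
  · by_cases ha : G.Adj i j
    · obtain ⟨w, hw1, hw2, hw3, hw4⟩ : ∃ w : Fin n, w ≠ i ∧ w ≠ j ∧ ¬ G.Adj i w ∧ ¬ G.Adj w j := by
        have hi := i.2
        have hj := j.2
        simp only [hG, parG, ne_eq, Fin.ext_iff] at ha ⊢
        by_cases h01 : i.val + j.val = 1
        · exact ⟨⟨4, by omega⟩, by simp only; omega⟩
        · rcases lt_or_ge i.val j.val with h | h
          · by_cases h2 : j.val = 2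
            · exact ⟨⟨3, by omega⟩, by simp only; omega⟩
            · exact ⟨⟨j.val - 1, by omega⟩, by simp only; omega⟩
          · by_cases h2 : i.val = 2
            · exact ⟨⟨3, by omega⟩, by simp only; omega⟩
            · exact ⟨⟨i.val - 1, by omega⟩, by simp only; omega⟩
      have a1 : Gᶜ.Adj i w := by simp [hw1.symm, hw3]
      have a2 : Gᶜ.Adj w j := by simp [hw2, hw4]
      have h1 : Gᶜ.dist i j ≤ 2 := SimpleGraph.dist_le (SimpleGraph.Walk.cons a1 a2.toWalk)
      have h2 : 1 < Gᶜ.dist i j :=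
        (a1.reachable.trans a2.reachable).one_lt_dist_of_ne_of_not_adj hij (by simp [ha])
      have : Gᶜ.dist i j = 2 := by omega
      rw [this]; simp [hij, ha]; norm_num
    · have : Gᶜ.dist i j = 1 := SimpleGraph.dist_eq_one_iff_adj.2 (by simp [hij, ha])
      rw [this]; simp [hij, ha]

/-! Sums over adjacency -/

theorem wt_sum {n : ℕ} (G : SimpleGraph (Fin n)) [DecidableRel G.Adj] (i : Fin n)
    (g : Fin n → ℝ) :
    ∑ j, wt G i j * g j = (∑ j, g j) - g i + ∑ j, (if G.Adj i j then g j else 0) := by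
  classical
  have : ∀ j, wt G i j * g j
      = g j - (if i = j then g j else 0) + (if G.Adj i j then g j else 0) := by
    intro j
    unfold wt
    by_cases h : i = j <;> by_cases h2 : G.Adj i j <;> simp [h, h2] <;> ring
  simp only [this, Finset.sum_add_distrib, Finset.sum_sub_distrib, Finset.sum_ite_eq,
    Finset.mem_univ, if_true]

theorem par_sum {n : ℕ} {p : ℕ → ℕ} (hp : ∀ k, p k ≤ k - 2) [DecidableRel (parG n p).Adj]
    (q : Fin n → Fin n) (hq : ∀ k, (q k).val = p k.val) (h : Fin n → Fin n → ℝ) :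
    ∑ i, ∑ j, (if (parG n p).Adj i j then h i j else 0)
      = ∑ k : Fin n, (if 0 < k.val then h k (q k) + h (q k) k else 0) := by
  classical
  have e : ∀ i j, (if (parG n p).Adj i j then h i j else 0)
      = (if q i = j then (if 0 < i.val then h i j else 0) else 0)
        + (if q j = i then (if 0 < j.val then h i j else 0) else 0) := by
    intro i j
    have hi := hp i; have hj := hp j
    have qi := hq i; have qj := hq j
    have : (parG n p).Adj i j ↔ (0 < i.val ∧ q i = j) ∨ (0 < j.val ∧ q j = i) := by
      simp only [parG, ne_eq, Fin.ext_iff]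
      omega
    have hne : ¬ ((0 < i.val ∧ q i = j) ∧ (0 < j.val ∧ q j = i)) := by
      simp only [Fin.ext_iff]; omega
    by_cases h1 : 0 < i.val <;> by_cases h2 : q i = j <;> by_cases h3 : 0 < j.val <;>
      by_cases h4 : q j = i <;> simp only [this, h1, h2, h3, h4, and_true, and_false, true_and,
        false_and, or_true, or_false, if_true, if_false, add_zero, zero_add, true_or] <;>
        exact absurd ⟨⟨h1, h2⟩, h3, h4⟩ hne
  simp only [e, Finset.sum_add_distrib]
  rw [Finset.sum_comm (f := fun i j => if q j = i then (if 0 < j.val then h i j else 0) else 0)]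
  simp only [Finset.sum_ite_eq, Finset.mem_univ, if_true]
  rw [← Finset.sum_add_distrib]
  refine Finset.sum_congr rfl fun k _ => ?_
  split_ifs <;> simp

/-- first neighbour in the zigzag path -/
def sn (k : ℕ) : ℕ := if k = 0 then 1 else k - 2

theorem fin_sum_single {n : ℕ} (c : ℕ) (Y : ℕ → ℝ) :
    ∑ l : Fin n, (if l.val = c then Y l.val else 0) = if c < n then Y c else 0 := by
  rw [Fin.sum_univ_eq_sum_range (fun l => if l = c then Y l else 0)]
  simp

theorem zig_sum {n : ℕ} (hn : 5 ≤ n) [DecidableRel (parG n (fun k => k - 2)).Adj] (i : Fin n)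
    (Y : ℕ → ℝ) :
    ∑ l : Fin n, (if (parG n (fun k => k - 2)).Adj i l then Y l.val else 0)
      = Y (sn i.val) + if i.val + 2 < n then Y (i.val + 2) else 0 := by
  have e : ∀ l : Fin n, (if (parG n (fun k => k - 2)).Adj i l then Y l.val else 0)
      = (if l.val = sn i.val then Y l.val else 0) + (if l.val = i.val + 2 then Y l.val else 0) := by
    intro l
    have : (parG n (fun k => k - 2)).Adj i l ↔ (l.val = sn i.val) ∨ (l.val = i.val + 2) := by
      simp only [parG, ne_eq, Fin.ext_iff, sn]
      split_ifs <;> omega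
    have hne : ¬ ((l.val = sn i.val) ∧ (l.val = i.val + 2)) := by
      simp only [sn]; split_ifs <;> omega
    simp only [this]
    by_cases h1 : l.val = sn i.val <;> by_cases h2 : l.val = i.val + 2
    · exact absurd ⟨h1, h2⟩ hne
    · rw [if_pos (Or.inl h1), if_pos h1, if_neg h2, add_zero]
    · rw [if_pos (Or.inr h2), if_neg h1, if_pos h2, zero_add]
    · rw [if_neg (by tauto), if_neg h1, if_neg h2, add_zero]
  simp only [e, Finset.sum_add_distrib, fin_sum_single]
  have : sn i.val < n := by simp only [sn]; split_ifs <;> omega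
  simp [this]

theorem zig_mulVec {n : ℕ} (hn : 5 ≤ n) (α : ℝ) (Y : ℕ → ℝ) (i : Fin n) :
    (Dalpha (parG n (fun k => k - 2))ᶜ α).mulVec (fun k => Y k.val) i
      = ((n : ℝ) - 1) * α * Y i + (1 - α) * ((∑ j : Fin n, Y j.val) - Y i)
        + (α * Y i + (1 - α) * Y (sn i))
        + if i.val + 2 < n then α * Y i + (1 - α) * Y (i.val + 2) else 0 := by
  classical
  rw [Dalpha_mulVec]
  simp only [zig_dist hn]
  rw [wt_sum _ i (fun j => α * Y i.val + (1 - α) * Y j.val),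
    zig_sum hn i (fun j => α * Y i.val + (1 - α) * Y j)]
  have hs : ∑ j : Fin n, (α * Y i.val + (1 - α) * Y j.val)
      = n * (α * Y i.val) + (1 - α) * ∑ j : Fin n, Y j.val := by
    rw [Finset.sum_add_distrib, Finset.mul_sum]; simp
  rw [hs]
  ring

theorem core_antitone (n : ℕ) (hn : 5 ≤ n) (Y : ℕ → ℝ) (α c K : ℝ) (h0 : 0 ≤ α) (h1 : α ≤ 1)
    (hc : 2 < c) (hY : ∀ k, k < n → 0 ≤ Y k)
    (E : ∀ k, k < n → c * Y k = K + (α * Y k + (1 - α) * Y (sn k))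
      + if k + 2 < n then α * Y k + (1 - α) * Y (k + 2) else 0) :
    ∀ k, k + 1 < n → Y (k + 1) ≤ Y k := by
  obtain ⟨k, hk, hmin⟩ := Finset.exists_min_image (Finset.range (n - 1))
    (fun k => Y k - Y (k + 1)) ⟨0, by simp; omega⟩
  simp only [Finset.mem_range] at hk hmin
  suffices hs : 0 ≤ Y k - Y (k + 1) by
    intro j hj
    have := hmin j (by omega)
    linarith
  by_contra hneg
  push Not at hneg
  obtain ⟨m, hm⟩ : ∃ m, m = Y k - Y (k + 1) := ⟨_, rfl⟩
  rw [← hm] at hneg hmin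
  have hb : 0 ≤ 1 - α := by linarith
  have E1 := E k (by omega)
  have E2 := E (k + 1) (by omega)
  have cm : (c - 2) * m < 0 := mul_neg_of_pos_of_neg (by linarith) hneg
  have am : (1 - α) * m ≤ 0 := mul_nonpos_of_nonneg_of_nonpos hb hneg.le
  have am' : α * m ≤ 0 := mul_nonpos_of_nonneg_of_nonpos h0 hneg.le
  have hB : ∀ j, j < n - 1 → (1 - α) * m ≤ (1 - α) * (Y j - Y (j + 1)) := fun j hj =>
    mul_le_mul_of_nonneg_left (hmin j hj) hb
  rcases Nat.lt_or_ge k 2 with hk2 | hk2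
  · interval_cases k
    · have := hB 2 (by omega)
      simp only [sn, show (0 + 2 < n) by omega, show (0 + 1 + 2 < n) by omega, if_true] at E1 E2
      norm_num at E1 E2 hm this
      subst hm
      nlinarith
    · have := hB 3 (by omega)
      simp only [sn, show (1 + 2 < n) by omega, show (1 + 1 + 2 < n) by omega, if_true] at E1 E2
      norm_num at E1 E2 hm this
      subst hm
      nlinarith
  · have t1 := hB (k - 2) (by omega)
    have s1 : sn k = k - 2 := by simp [sn]; omega
    have s2 : sn (k + 1) = k - 2 + 1 := by simp [sn]; omega
    rw [s1] at E1
    rw [s2] at E2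
    have y1 := mul_nonneg h0 (hY (k + 1) (by omega))
    rcases Nat.lt_or_ge (k + 3) n with h3 | h3
    · have t2 := hB (k + 2) (by omega)
      rw [if_pos (by omega)] at E1 E2
      rw [show k + 1 + 2 = k + 2 + 1 by omega] at E2
      subst hm
      nlinarith
    · rw [if_neg (by omega)] at E2
      rcases Nat.lt_or_ge (k + 2) n with h4 | h4
      · have y2 := mul_nonneg hb (hY (k + 2) (by omega))
        rw [if_pos h4] at E1
        subst hm
        nlinarith
      · rw [if_neg (by omega)] at E1
        subst hm
        nlinarith

theorem nonneg_top {n : ℕ} (hn : 0 < n) (G : SimpleGraph (Fin n)) (α : ℝ) (h1 : α ≤ 1) :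
    ∃ v : Fin n → ℝ, v ≠ 0 ∧ (∀ i, 0 ≤ v i) ∧ (Dalpha G α).mulVec v = lam1 (Dalpha G α) • v := by
  obtain ⟨v, hv, h⟩ := lam_mem hn _ (Dalpha_herm G α)
  refine ⟨fun i => |v i|, ?_, fun i => abs_nonneg _, ?_⟩
  · intro h0; apply hv; ext i
    have := congrFun h0 i
    simpa using this
  · apply lam_eq _ (Dalpha_herm G α)
    have e1 : (fun i => |v i|) ⬝ᵥ (fun i => |v i|) = v ⬝ᵥ v := by
      simp [dotProduct]
    have e2 : lam1 (Dalpha G α) * (v ⬝ᵥ v) = v ⬝ᵥ (Dalpha G α).mulVec v := by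
      rw [h, dotProduct_smul, smul_eq_mul]
    rw [e1, e2, Dalpha_quad, Dalpha_quad]
    refine Finset.sum_le_sum fun i _ => Finset.sum_le_sum fun j _ => ?_
    have : v i * v j ≤ |v i| * |v j| := by rw [← abs_mul]; exact le_abs_self _
    have h2 := mul_le_mul_of_nonneg_left this (show 0 ≤ 1 - α by linarith)
    refine mul_le_mul_of_nonneg_left ?_ (Nat.cast_nonneg _)
    rw [sq_abs]
    linarith

theorem zig_lower {n : ℕ} (hn : 5 ≤ n) (α : ℝ) :
    ((n : ℝ) + 1) * α + 2 * (1 - α) ≤ lam1 (Dalpha (parG n (fun k => k - 2))ᶜ α) := by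
  set Y : ℕ → ℝ := fun k => if k < 2 then 1 else 0 with hY
  have hsum : ∀ g : ℕ → ℝ, ∑ j : Fin n, Y j.val * g j.val = g 0 + g 1 := by
    intro g
    rw [Fin.sum_univ_eq_sum_range (fun j => Y j * g j) n]
    rw [← Finset.sum_subset (s₁ := Finset.range 2)]
    · simp [Finset.sum_range_succ, hY]
    · intro x hx; simp at hx ⊢; omega
    · intro x _ hx; simp at hx; simp [hY, hx]
  have hS : ∑ j : Fin n, Y j.val = 2 := by
    have := hsum (fun _ => 1)
    simp only [mul_one] at this
    rw [this]; norm_num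
  have h := lam_ray _ (Dalpha_herm (parG n (fun k => k - 2))ᶜ α) (fun k => Y k.val)
  simp only [dotProduct, zig_mulVec hn, hS] at h
  rw [hsum Y, hsum (fun i => ((n : ℝ) - 1) * α * Y i + (1 - α) * (2 - Y i)
        + (α * Y i + (1 - α) * Y (sn i))
        + if i + 2 < n then α * Y i + (1 - α) * Y (i + 2) else 0)] at h
  have l1 : 0 + 2 < n := by omega
  have l2 : 1 + 2 < n := by omega
  simp only [hY, sn, l1, l2] at h
  norm_num at h
  linarith

theorem zig_vec {n : ℕ} (hn : 5 ≤ n) (α : ℝ) (h0 : 0 ≤ α) (h1 : α < 1) :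
    ∃ v : Fin n → ℝ, (∀ i, 0 < v i) ∧ (∀ i j, i ≤ j → v j ≤ v i) ∧
      (Dalpha (parG n (fun k => k - 2))ᶜ α).mulVec v
        = lam1 (Dalpha (parG n (fun k => k - 2))ᶜ α) • v := by
  obtain ⟨v, hv, hpos, h⟩ := nonneg_top (by omega) (parG n (fun k => k - 2))ᶜ α h1.le
  set μ := lam1 (Dalpha (parG n (fun k => k - 2))ᶜ α) with hμ
  set Y : ℕ → ℝ := fun k => if hk : k < n then v ⟨k, hk⟩ else 0 with hY
  have hYv : ∀ i : Fin n, Y i.val = v i := by intro i; simp [hY]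
  have hv' : (fun k : Fin n => Y k.val) = v := funext hYv
  have hYn : ∀ k, 0 ≤ Y k := by
    intro k; simp only [hY]; split_ifs; exacts [hpos _, le_rfl]
  have hlow := zig_lower hn α
  rw [← hμ] at hlow
  have E : ∀ k, k < n → (μ - ((n : ℝ) - 1) * α + (1 - α)) * Y k
      = (1 - α) * (∑ j : Fin n, Y j.val) + (α * Y k + (1 - α) * Y (sn k))
      + if k + 2 < n then α * Y k + (1 - α) * Y (k + 2) else 0 := by
    intro k hk
    have := congrFun h ⟨k, hk⟩
    rw [← hv', zig_mulVec hn] at this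
    simp only [Pi.smul_apply, smul_eq_mul] at this
    linarith
  have hanti := core_antitone n hn Y α _ _ h0 h1.le (by linarith) (fun k _ => hYn k) E
  have hS : 0 < ∑ j : Fin n, Y j.val := by
    obtain ⟨i, hi⟩ := Function.ne_iff.1 hv
    refine Finset.sum_pos' (fun j _ => hYn _) ⟨i, Finset.mem_univ _, ?_⟩
    rw [hYv]; exact lt_of_le_of_ne (hpos i) (Ne.symm hi)
  refine ⟨v, ?_, ?_, h⟩
  · intro i
    refine lt_of_le_of_ne (hpos i) fun hi => ?_
    have := E i i.2
    rw [hYv, ← hi] at this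
    have a1 := mul_pos (sub_pos.2 h1) hS
    have a2 := mul_nonneg (sub_pos.2 h1).le (hYn (sn i))
    have a3 := mul_nonneg (sub_pos.2 h1).le (hYn (i + 2))
    split_ifs at this <;> linarith
  · have : ∀ d k, k + d < n → Y (k + d) ≤ Y k := by
      intro d
      induction d with
      | zero => intro k _; exact le_rfl
      | succ d ih => intro k hk; exact (hanti (k + d) hk).trans (ih k (by omega))
    intro i j hij
    have h2 := this (j.val - i.val) i.val (by omega)
    rw [show i.val + (j.val - i.val) = j.val by omega, hYv, hYv] at h2
    exact h2

/-- comparison of quadratic forms -/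
theorem quad_cmp {n : ℕ} (hn : 5 ≤ n) {p : ℕ → ℕ} (hp : ∀ k, p k ≤ k - 2)
    (hc : (parG n p)ᶜ.Preconnected) (α : ℝ) (h0 : 0 ≤ α) (h1 : α ≤ 1) (v : Fin n → ℝ)
    (hv : ∀ i, 0 < v i) (ha : ∀ i j, i ≤ j → v j ≤ v i) :
    v ⬝ᵥ (Dalpha (parG n (fun k => k - 2))ᶜ α).mulVec v ≤ v ⬝ᵥ (Dalpha (parG n p)ᶜ α).mulVec v := by
  classical
  have hb : 0 ≤ 1 - α := by linarith
  rw [Dalpha_quad, Dalpha_quad]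
  have hlow : ∑ i, ∑ j, wt (parG n p) i j * (α * v i ^ 2 + (1 - α) * (v i * v j))
      ≤ ∑ i, ∑ j, ((parG n p)ᶜ.dist i j : ℝ) * (α * v i ^ 2 + (1 - α) * (v i * v j)) := by
    refine Finset.sum_le_sum fun i _ => Finset.sum_le_sum fun j _ => ?_
    refine mul_le_mul_of_nonneg_right (wt_le _ hc i j) ?_
    have := mul_nonneg hb (mul_pos (hv i) (hv j)).le
    have := mul_nonneg h0 (sq_nonneg (v i))
    linarith
  refine le_trans ?_ hlow
  simp only [zig_dist hn]
  have e : ∀ G : SimpleGraph (Fin n), ∀ i,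
      ∑ j, wt G i j * (α * v i ^ 2 + (1 - α) * (v i * v j)) = _ :=
    fun G i => wt_sum G i (fun j => α * v i ^ 2 + (1 - α) * (v i * v j))
  simp only [e, Finset.sum_add_distrib]
  refine add_le_add le_rfl ?_
  have hlt : ∀ k : Fin n, p k.val < n := fun k => by have := hp k.val; omega
  rw [par_sum (p := fun k => k - 2) (fun k => le_rfl) (fun k => ⟨k.val - 2, by omega⟩) (fun k => rfl)
      (fun i j => α * v i ^ 2 + (1 - α) * (v i * v j)),
    par_sum hp (fun k => ⟨p k.val, hlt k⟩) (fun k => rfl)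
      (fun i j => α * v i ^ 2 + (1 - α) * (v i * v j))]
  refine Finset.sum_le_sum fun k _ => ?_
  split_ifs
  · have hle : v ⟨k.val - 2, by omega⟩ ≤ v ⟨p k.val, hlt k⟩ := ha _ _ (hp k.val)
    have hapos : 0 < v ⟨k.val - 2, by omega⟩ := hv _
    have hbk := mul_le_mul_of_nonneg_left (mul_le_mul_of_nonneg_left hle (hv k).le) hb
    have hsq := mul_le_mul_of_nonneg_left (pow_le_pow_left₀ hapos.le hle 2) h0
    linarith
  · exact le_rfl

theorem par_main {n : ℕ} (hn : 5 ≤ n) {p : ℕ → ℕ} (hp : ∀ k, p k ≤ k - 2)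
    (hc : (parG n p)ᶜ.Preconnected) (α : ℝ) (h0 : 0 ≤ α) (h1 : α ≤ 1)
    (hne : ∃ k, k < n ∧ p k ≠ k - 2) :
    lam1 (Dalpha (parG n (fun k => k - 2))ᶜ α) < lam1 (Dalpha (parG n p)ᶜ α) := by
  classical
  obtain ⟨k, hkn, hkp, hmin⟩ : ∃ k, k < n ∧ p k ≠ k - 2 ∧ ∀ m, m < k → p m = m - 2 := by
    refine ⟨Nat.find hne, (Nat.find_spec hne).1, (Nat.find_spec hne).2, ?_⟩
    intro m hm
    have := Nat.find_min hne hm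
    have h2 := (Nat.find_spec hne).1
    by_contra h3
    exact this ⟨by omega, h3⟩
  have hpk := hp k
  have hk3 : p k + 3 ≤ k := by omega
  obtain ⟨j, hjv⟩ : ∃ j : Fin n, j.val = p k := ⟨⟨p k, by omega⟩, rfl⟩
  obtain ⟨kf, hkfv⟩ : ∃ kf : Fin n, kf.val = k := ⟨⟨k, hkn⟩, rfl⟩
  have hsub : ∀ i, (parG n (fun k => k - 2)).Adj j i → (parG n p).Adj j i := by
    intro i
    simp only [parG, ne_eq, Fin.ext_iff, hjv]
    rintro ⟨a1, a2⟩
    refine ⟨a1, ?_⟩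
    have m1 := hmin (p k) (by omega)
    rcases a2 with a2 | a2
    · left; omega
    · right; have := hmin i.val (by omega); omega
  have hkadj : (parG n p).Adj j kf := by
    refine ⟨fun h => ?_, Or.inr ⟨by omega, by rw [hkfv, hjv]⟩⟩
    have := congrArg Fin.val h
    omega
  have hknadj : ¬ (parG n (fun k => k - 2)).Adj j kf := by
    simp only [parG, ne_eq, Fin.ext_iff, hjv, hkfv]
    omega
  have hd : ∀ i, ((parG n (fun k => k - 2))ᶜ.dist j i : ℝ) ≤ ((parG n p)ᶜ.dist j i : ℝ) := by
    intro i
    rw [zig_dist hn]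
    refine le_trans ?_ (wt_le _ hc j i)
    unfold wt
    by_cases a : (parG n (fun k => k - 2)).Adj j i
    · simp [a, hsub i a]
    · simp only [a, if_false]; split_ifs <;> norm_num
  have hdk : ((parG n (fun k => k - 2))ᶜ.dist j kf : ℝ) < ((parG n p)ᶜ.dist j kf : ℝ) := by
    rw [zig_dist hn]
    refine lt_of_lt_of_le ?_ (wt_le _ hc j kf)
    unfold wt
    simp [hkadj, hknadj]
  have hstrict : ∀ v : Fin n → ℝ, (∀ i, 0 ≤ α * v j + (1 - α) * v i) →
      0 < α * v j + (1 - α) * v kf →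
      (Dalpha (parG n (fun k => k - 2))ᶜ α).mulVec v j < (Dalpha (parG n p)ᶜ α).mulVec v j := by
    intro v hv1 hv2
    rw [Dalpha_mulVec, Dalpha_mulVec]
    refine Finset.sum_lt_sum (fun i _ => mul_le_mul_of_nonneg_right (hd i) (hv1 i))
      ⟨kf, Finset.mem_univ _, mul_lt_mul_of_pos_right hdk hv2⟩
  rcases h1.lt_or_eq with h1' | h1'
  · obtain ⟨v, hv, ha, hev⟩ := zig_vec hn α h0 h1'
    have hb : 0 < 1 - α := by linarith
    have hq := quad_cmp hn hp hc α h0 h1 v hv ha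
    rw [hev, dotProduct_smul, smul_eq_mul] at hq
    have hs := hstrict v
      (fun i => add_nonneg (mul_nonneg h0 (hv j).le) (mul_nonneg hb.le (hv i).le))
      (add_pos_of_nonneg_of_pos (mul_nonneg h0 (hv j).le) (mul_pos hb (hv kf)))
    by_contra hcon
    push Not at hcon
    have hvv : 0 ≤ v ⬝ᵥ v := Finset.sum_nonneg fun i _ => mul_self_nonneg _
    have he := lam_eq _ (Dalpha_herm (parG n p)ᶜ α) v
      ((mul_le_mul_of_nonneg_right hcon hvv).trans hq)
    rw [hev, he] at hs
    simp only [Pi.smul_apply, smul_eq_mul] at hs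
    have := mul_le_mul_of_nonneg_right hcon (hv j).le
    linarith
  · subst h1'
    obtain ⟨v, hv, h⟩ := lam_mem (by omega) _ (Dalpha_herm (parG n (fun k => k - 2))ᶜ 1)
    obtain ⟨i, hi⟩ := Function.ne_iff.1 hv
    have f1 := zig_mulVec hn 1 (fun _ => 1) i
    have f2 := zig_mulVec hn 1 (fun _ => 1) j
    have g1 := congrFun h i
    have e1 : (Dalpha (parG n (fun k => k - 2))ᶜ 1).mulVec v i
        = (Dalpha (parG n (fun k => k - 2))ᶜ 1).mulVec (fun _ => 1) i * v i := by
      rw [Dalpha_mulVec, Dalpha_mulVec, Finset.sum_mul]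
      exact Finset.sum_congr rfl fun _ _ => by ring
    rw [e1] at g1
    have g2 := mul_right_cancel₀ hi g1
    rw [← g2]
    have hs := hstrict (fun _ => 1) (fun _ => by norm_num) (by norm_num)
    have r := lam_ray _ (Dalpha_herm (parG n p)ᶜ 1) (Pi.single j 1)
    rw [single_one_dotProduct, single_one_dotProduct, Pi.single_eq_same, mul_one] at r
    have e2 : (Dalpha (parG n p)ᶜ 1).mulVec (Pi.single j 1) j
        = (Dalpha (parG n p)ᶜ 1).mulVec (fun _ => 1) j := by
      rw [Dalpha_mulVec, Dalpha_mulVec]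
      exact Finset.sum_congr rfl fun _ _ => by simp
    rw [e2] at r
    refine lt_of_le_of_lt ?_ (hs.trans_le r)
    rw [f1, f2, if_pos (show j.val + 2 < n by omega)]
    split_ifs <;> norm_num

theorem star_iso {n : ℕ} {G H : SimpleGraph (Fin n)} (e : G ≃g H) (h : IsStar H) : IsStar G := by
  obtain ⟨c, hc⟩ := h
  refine ⟨e.symm c, fun a b => ?_⟩
  rw [← e.map_adj_iff, hc]
  have h1 : ∀ x, e x = c ↔ x = e.symm c := fun x => by
    constructor
    · rintro rfl; simp
    · rintro rfl; simp
  rw [h1, h1]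
  simp
theorem stmt_12 (α : ℝ) (hα : α ∈ Set.Icc (0 : ℝ) 1) (n : ℕ) (hn : 4 ≤ n)
    (T : SimpleGraph (Fin n)) (hT : T.IsTree)
    (hstar : ¬ IsStar T) (hpath : ¬ Nonempty (T ≃g SimpleGraph.pathGraph n)) :
    lam1 (Dalpha Tᶜ α) > lam1 (Dalpha (SimpleGraph.pathGraph n)ᶜ α) := by
  obtain ⟨m, rfl⟩ : ∃ m, n = m + 2 := ⟨n - 2, by omega⟩
  obtain ⟨p, hp, e, -⟩ := order_aux m (Fin (m + 2)) T hT (by simp) ⟨0, by omega⟩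
  obtain ⟨z⟩ := path_zig (m + 2)
  have hns : ¬ IsStar (parG (m + 2) p) := fun h => hstar (star_iso e h)
  have hne : ∃ k, k < m + 2 ∧ p k ≠ k - 2 := by
    by_contra hcon
    push Not at hcon
    apply hpath
    have : parG (m + 2) p = parG (m + 2) (fun k => k - 2) := by
      ext a b
      simp only [parG, hcon a.val a.2, hcon b.val b.2]
    rw [this] at e
    exact ⟨e.trans z.symm⟩
  rw [lam1_iso (complIso e) α, lam1_iso (complIso z) α]
  rcases Nat.lt_or_ge 4 (m + 2) with h5 | h5
  · exact par_main h5 hp (par_reach hp hns) α hα.1 hα.2 hne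
  · exfalso
    apply hns
    obtain ⟨k, hk1, hk2⟩ := hne
    have hp1 := hp 1
    have hp2 := hp 2
    have hp3 := hp 3
    have hp0 := hp 0
    have hm : m = 2 := by omega
    subst hm
    have h3 : p 3 = 0 := by
      interval_cases k <;> omega
    have h1 : p 1 = 0 := by omega
    have h2 : p 2 = 0 := by omega
    refine ⟨0, fun a b => ?_⟩
    have ha : 0 < a.val → p a.val = 0 := by
      intro h; obtain ⟨a, ha⟩ := a; simp only at h ⊢; interval_cases a <;> assumption
    have hb : 0 < b.val → p b.val = 0 := by
      intro h; obtain ⟨b, hb⟩ := b; simp only at h ⊢; interval_cases b <;> assumption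
    simp only [parG, ne_eq, Fin.ext_iff, Fin.val_zero]
    omega
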